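/- For d ∈ Q, set R_d = {γ ∈ Δ⁺ \ K : γ(x_K) = d}. Then the map γ ↦ β_j − γ, where j is the unique index with γ ∈ H_{β_j}, is a bijection between R_d and R_{1−d}. In particular, the multiplicity m_d = #R_d of each value d of x_K on Δ⁺ \ K satisfies m_d = m_{1−d}, i.e., the multiset of values {γ(x_K) : γ ∈ Δ⁺ \ K} is symmetric with respect to 1/2. -/

import Mathlib

open scoped RealInnerProductSpace

attribute [local instance] Classical.propDecidable

section RootCombinatorics

variable {V : Type*} [NormedAddCommGroup V] [InnerProductSpace ℝ V]

/-- The Cartan pairing `⟨γ, α∨⟩ = 2 (γ, α) / (α, α)`. -/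
noncomputable def cartanPairing (γ α : V) : ℝ := 2 * ⟪γ, α⟫ / ⟪α, α⟫

/-- The coroot `γ∨ = 2 γ / (γ, γ)`. -/
noncomputable def covec (γ : V) : V := (2 / ⟪γ, γ⟫) • γ

/-- The cascade element `x_K = Σ_{β ∈ K} β / (β, β) = ½ Σ_{β ∈ K} β∨`. -/
noncomputable def cascElt (K : Finset V) : V := ∑ β ∈ K, (⟪β, β⟫)⁻¹ • β

/-- The roots of `S` orthogonal to `β`. -/
noncomputable def orthSub (S : Finset V) (β : V) : Finset V := S.filter fun γ => ⟪γ, β⟫ = 0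

/-- One step of the non-orthogonality (connectedness) relation inside `S`. -/
def connRel (S : Finset V) (a b : V) : Prop := a ∈ S ∧ b ∈ S ∧ ⟪a, b⟫ ≠ 0

/-- The irreducible component of the root subsystem `S` containing `γ`. -/
noncomputable def component (S : Finset V) (γ : V) : Finset V :=
  S.filter fun γ' => Relation.ReflTransGen (connRel S) γ γ'

/-- `C` is an irreducible component of the root subsystem `S`. -/
def IsComponent (S C : Finset V) : Prop := ∃ γ ∈ S, C = component S γ

end RootCombinatorics

/-- The combinatorial data of an irreducible crystallographic root system with a chosen
system of positive roots, base (set of simple roots) and highest root: the combinatorial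
skeleton of a finite-dimensional complex simple Lie algebra, with the Killing-form
identification of the Cartan subalgebra and its dual. -/
structure RootSystemCtx (V : Type*) [NormedAddCommGroup V] [InnerProductSpace ℝ V] where
  /-- the set of roots Δ -/
  Δ : Finset V
  /-- the set of simple roots Π -/
  base : Finset V
  /-- the set of positive roots Δ⁺ -/
  Pos : Finset V
  /-- the highest root θ -/
  θ : V
  zero_not_mem : (0 : V) ∉ Δ
  neg_mem : ∀ γ ∈ Δ, -γ ∈ Δ
  reflect_mem : ∀ α ∈ Δ, ∀ γ ∈ Δ, γ - cartanPairing γ α • α ∈ Δ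
  pairing_int : ∀ α ∈ Δ, ∀ γ ∈ Δ, ∃ k : ℤ, cartanPairing γ α = (k : ℝ)
  span_eq : Submodule.span ℝ (Δ : Set V) = ⊤
  base_subset : base ⊆ Pos
  base_indep : LinearIndependent ℝ (fun a : {x // x ∈ base} => (a : V))
  pos_subset : Pos ⊆ Δ
  pos_or_neg : ∀ γ ∈ Δ, γ ∈ Pos ∨ -γ ∈ Pos
  pos_not_neg : ∀ γ ∈ Pos, -γ ∉ Pos
  pos_coords : ∀ γ ∈ Pos, γ ∈ AddSubmonoid.closure (base : Set V)
  irreducible : ∀ S : Finset V, S ⊆ Δ → S.Nonempty →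
    (∀ a ∈ S, ∀ b ∈ Δ, b ∉ S → ⟪a, b⟫ = 0) → S = Δ
  theta_mem : θ ∈ Pos
  theta_highest : ∀ γ ∈ Δ, θ - γ ∈ AddSubmonoid.closure (base : Set V)

namespace RootSystemCtx

variable {V : Type*} [NormedAddCommGroup V] [InnerProductSpace ℝ V]

variable (ctx : RootSystemCtx V)

/-- The root order `γ ≼ γ'` on roots: `γ' - γ` is a nonnegative integral combination of
simple roots. -/
def rootLE (γ γ' : V) : Prop := γ' - γ ∈ AddSubmonoid.closure (ctx.base : Set V)

/-- `β` is the highest root of the root subsystem `S` (with respect to the ambient positive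
system). -/
def IsHighest (S : Finset V) (β : V) : Prop :=
  β ∈ S ∧ β ∈ ctx.Pos ∧ ∀ γ ∈ S, ctx.rootLE γ β

/-- `CascadeMem ctx S β` : the pair (root subsystem `S = Δ⟨i⟩`, its highest root `β = βᵢ`)
occurs in the recursive construction of the Kostant cascade: one starts with `(Δ, θ)`, and the
descendants of `(S, β)` are the pairs `(C, β')` where `C` is an irreducible component of
`{γ ∈ S | (γ, β) = 0}` and `β'` is the highest root of `C`. -/
inductive CascadeMem : Finset V → V → Prop
  | top : CascadeMem ctx.Δ ctx.θ
  | step {S C : Finset V} {β β' : V} : CascadeMem S β →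
      IsComponent (orthSub S β) C → ctx.IsHighest C β' → CascadeMem C β'

/-- `K` is the Kostant cascade of the root system. -/
def IsCascade (K : Finset V) : Prop := ∀ β, β ∈ K ↔ ∃ S, ctx.CascadeMem S β

/-- The Heisenberg subset `H_β = {γ ∈ S ∩ Δ⁺ : (γ, β) > 0}` attached to a cascade pair
`(S, β)`. -/
noncomputable def heis (S : Finset V) (β : V) : Finset V :=
  S.filter fun γ => γ ∈ ctx.Pos ∧ 0 < ⟪γ, β⟫

/-- A root is long if it has the same length as the highest root. -/
def IsLong (γ : V) : Prop := ⟪γ, γ⟫ = ⟪ctx.θ, ctx.θ⟫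

/-- The highest root `θ` is a fundamental weight. -/
def ThetaFundamental : Prop :=
  ∃ α ∈ ctx.base, cartanPairing ctx.θ α = 1 ∧
    ∀ β ∈ ctx.base, β ≠ α → cartanPairing ctx.θ β = 0

/-- `β'` is a descendant of the cascade element `β`. -/
def Desc (β β' : V) : Prop :=
  ∃ S C, ctx.CascadeMem S β ∧ IsComponent (orthSub S β) C ∧ ctx.IsHighest C β'

/-- The cascade poset order: `β ≤ β'` iff `β` is an iterated descendant of `β'`. -/
def cascLE (β β' : V) : Prop := Relation.ReflTransGen (fun a b => ctx.Desc b a) β β'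

/-- A simple reflection of the root system. -/
def IsSimpleReflection (w : V ≃ₗ[ℝ] V) : Prop :=
  ∃ α ∈ ctx.base, ∀ v, w v = v - (2 * ⟪v, α⟫ / ⟪α, α⟫) • α

/-- The Weyl group, generated by the simple reflections. -/
def weylGroup : Subgroup (V ≃ₗ[ℝ] V) := Subgroup.closure {w | ctx.IsSimpleReflection w}

/-- The length of a Weyl group element: the minimal number of simple reflections needed to
express it. -/
noncomputable def length (w : V ≃ₗ[ℝ] V) : ℕ :=
  sInf {n | ∃ l : List (V ≃ₗ[ℝ] V), l.length = n ∧
    (∀ s ∈ l, ctx.IsSimpleReflection s) ∧ l.prod = w}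

/-- The root system is of type `Aₙ` (Cartan matrix characterisation). -/
def IsTypeA (n : ℕ) : Prop :=
  1 ≤ n ∧ ∃ e : Fin n ≃ {x // x ∈ ctx.base}, ∀ i j : Fin n,
    cartanPairing (e i : V) (e j : V) =
      (if i = j then 2 else if i.val + 1 = j.val ∨ j.val + 1 = i.val then -1 else 0)

/-- The root system is of type `Bₙ` (`n ≥ 2`), with the last simple root short. -/
def IsTypeB (n : ℕ) : Prop :=
  2 ≤ n ∧ ∃ e : Fin n ≃ {x // x ∈ ctx.base}, ∀ i j : Fin n,
    cartanPairing (e i : V) (e j : V) =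
      (if i = j then 2
       else if i.val + 2 = n ∧ j.val + 1 = n then -2
       else if i.val + 1 = j.val ∨ j.val + 1 = i.val then -1 else 0)

/-- The root system is of type `Cₙ` (`n ≥ 2`), with the last simple root long. -/
def IsTypeC (n : ℕ) : Prop :=
  2 ≤ n ∧ ∃ e : Fin n ≃ {x // x ∈ ctx.base}, ∀ i j : Fin n,
    cartanPairing (e i : V) (e j : V) =
      (if i = j then 2
       else if i.val + 1 = n ∧ j.val + 2 = n then -2
       else if i.val + 1 = j.val ∨ j.val + 1 = i.val then -1 else 0)

/-- The root system is of type `G₂` (first simple root short). -/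
def IsTypeG2 : Prop :=
  ∃ e : Fin 2 ≃ {x // x ∈ ctx.base},
    cartanPairing (e 0 : V) (e 0 : V) = 2 ∧ cartanPairing (e 1 : V) (e 1 : V) = 2 ∧
    cartanPairing (e 0 : V) (e 1 : V) = -1 ∧ cartanPairing (e 1 : V) (e 0 : V) = -3

/-- The set of roots `Δ(a_z) = w(Δ⁺_z(-1)) ∪ w(-Δ⁺_z(2))` of the abelian ideal attached by
Kostant's construction to `z` (with `w = w_z`). -/
def idealSet (w : V ≃ₗ[ℝ] V) (x : V) : Set V :=
  {δ | ∃ γ ∈ ctx.Pos, (⟪γ, x⟫ = -1 ∧ δ = w γ) ∨ (⟪γ, x⟫ = 2 ∧ δ = -(w γ))}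

end RootSystemCtx

section RootSubsystem

variable {V : Type*} [NormedAddCommGroup V] [InnerProductSpace ℝ V]

theorem connRel_symm {S : Finset V} {a b : V} (h : connRel S a b) : connRel S b a :=
  ⟨h.2.1, h.1, by rw [real_inner_comm]; exact h.2.2⟩

theorem IsComponent.subset {S C : Finset V} (h : IsComponent S C) : C ⊆ S := by
  obtain ⟨γ, -, rfl⟩ := h
  exact Finset.filter_subset _ _

theorem IsComponent.mem_of_connRel {S C : Finset V} (h : IsComponent S C) {a b : V}
    (ha : a ∈ C) (hab : connRel S a b) : b ∈ C := by
  obtain ⟨γ, -, rfl⟩ := h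
  exact Finset.mem_filter.2 ⟨hab.2.1, (Finset.mem_filter.1 ha).2.tail hab⟩

theorem IsComponent.eq_component {S C : Finset V} (h : IsComponent S C) {a : V} (ha : a ∈ C) :
    C = component S a := by
  obtain ⟨γ, -, rfl⟩ := h
  have hγa : Relation.ReflTransGen (connRel S) γ a := (Finset.mem_filter.1 ha).2
  have haγ : Relation.ReflTransGen (connRel S) a γ :=
    have : Std.Symm (connRel S) := ⟨fun _ _ => connRel_symm⟩
    Std.Symm.symm _ _ hγa
  ext x
  simp only [component, Finset.mem_filter]
  exact and_congr_right fun _ => ⟨haγ.trans, hγa.trans⟩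

theorem IsComponent.inner_eq_zero {S C : Finset V} (h : IsComponent S C) {a b : V}
    (ha : a ∈ C) (hb : b ∈ S) (hbC : b ∉ C) : ⟪a, b⟫ = 0 := by
  by_contra hab
  exact hbC (h.mem_of_connRel ha ⟨h.subset ha, hb, hab⟩)

end RootSubsystem

namespace RootSystemCtx

variable {V : Type*} [NormedAddCommGroup V] [InnerProductSpace ℝ V] (ctx : RootSystemCtx V)

/-- The cone of nonnegative combinations of simple roots is pointed. -/
theorem eq_zero_of_mem_closure_base {x : V} (hx : x ∈ AddSubmonoid.closure (ctx.base : Set V))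
    (hx' : -x ∈ AddSubmonoid.closure (ctx.base : Set V)) : x = 0 := by
  obtain ⟨f, hf⟩ := LinearMap.exists_extend
    ((Module.Basis.span ctx.base_indep).constr ℝ (fun _ => (1 : ℝ)))
  have hfb : ∀ b ∈ ctx.base, f b = 1 := fun b hb => by
    have h := LinearMap.congr_fun hf (Module.Basis.span ctx.base_indep ⟨b, hb⟩)
    rw [Module.Basis.constr_basis] at h
    simpa [Module.Basis.span_apply] using h
  have key : ∀ y ∈ AddSubmonoid.closure (ctx.base : Set V), y = 0 ∨ 0 < f y := by
    intro y hy
    induction hy using AddSubmonoid.closure_induction with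
    | mem b hb => exact Or.inr (by rw [hfb b hb]; exact one_pos)
    | zero => exact Or.inl rfl
    | add y z _ _ hy hz =>
      rcases hy with rfl | hy
      · simpa using hz
      · rcases hz with rfl | hz
        · exact Or.inr (by simpa using hy)
        · exact Or.inr (by rw [map_add]; exact add_pos hy hz)
  rcases key x hx with h | h
  · exact h
  · rcases key _ hx' with h' | h'
    · exact neg_eq_zero.1 h'
    · rw [map_neg] at h'
      linarith

variable {ctx}

theorem ne_zero_of_mem {γ : V} (h : γ ∈ ctx.Δ) : γ ≠ 0 := fun h0 =>
  ctx.zero_not_mem (h0 ▸ h)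

theorem mem_pos_of_mem_closure {γ : V} (h : γ ∈ ctx.Δ)
    (hc : γ ∈ AddSubmonoid.closure (ctx.base : Set V)) : γ ∈ ctx.Pos :=
  (ctx.pos_or_neg γ h).resolve_right fun h' =>
    ne_zero_of_mem h (ctx.eq_zero_of_mem_closure_base hc (ctx.pos_coords _ h'))

theorem IsHighest.unique {S : Finset V} {β β' : V} (h : ctx.IsHighest S β)
    (h' : ctx.IsHighest S β') : β = β' := by
  rw [← sub_eq_zero]
  refine ctx.eq_zero_of_mem_closure_base (h.2.2 _ h'.1) ?_
  rw [neg_sub]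
  exact h'.2.2 _ h.1

/-- A subset of the roots closed under negation and under its own reflections. -/
structure IsSubsystem (ctx : RootSystemCtx V) (S : Finset V) : Prop where
  subset : S ⊆ ctx.Δ
  neg_mem : ∀ γ ∈ S, -γ ∈ S
  reflect_mem : ∀ α ∈ S, ∀ γ ∈ S, γ - cartanPairing γ α • α ∈ S

theorem IsSubsystem.orthSub {S : Finset V} (hS : ctx.IsSubsystem S) (β : V) :
    ctx.IsSubsystem (orthSub S β) where
  subset := (Finset.filter_subset _ _).trans hS.subset
  neg_mem γ hγ := by
    rw [_root_.orthSub, Finset.mem_filter] at hγ ⊢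
    exact ⟨hS.neg_mem _ hγ.1, by rw [inner_neg_left, hγ.2, neg_zero]⟩
  reflect_mem α hα γ hγ := by
    rw [_root_.orthSub, Finset.mem_filter] at hα hγ ⊢
    exact ⟨hS.reflect_mem _ hα.1 _ hγ.1, by
      rw [inner_sub_left, inner_smul_left, hγ.2, hα.2]; simp⟩

theorem IsSubsystem.isComponent {S C : Finset V} (hS : ctx.IsSubsystem S)
    (hC : IsComponent S C) : ctx.IsSubsystem C where
  subset := hC.subset.trans hS.subset
  neg_mem γ hγ := by
    have hγS := hC.subset hγ
    refine hC.mem_of_connRel hγ ⟨hγS, hS.neg_mem _ hγS, ?_⟩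
    rw [inner_neg_right, neg_ne_zero, inner_self_ne_zero]
    exact ne_zero_of_mem (hS.subset hγS)
  reflect_mem α hα γ hγ := by
    have hαS := hC.subset hα
    have hγS := hC.subset hγ
    by_cases h : ⟪γ, α⟫ = 0
    · simpa [cartanPairing, h] using hγ
    · refine hC.mem_of_connRel hα ⟨hαS, hS.reflect_mem _ hαS _ hγS, ?_⟩
      have hα0 : ⟪α, α⟫ ≠ 0 := inner_self_ne_zero.2 (ne_zero_of_mem (hS.subset hαS))
      rw [inner_sub_right, inner_smul_right, cartanPairing, div_mul_cancel₀ _ hα0,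
        real_inner_comm γ α]
      intro h'
      apply h
      linarith

theorem CascadeMem.isSubsystem {S : Finset V} {β : V} (h : ctx.CascadeMem S β) :
    ctx.IsSubsystem S := by
  induction h with
  | top => exact ⟨subset_rfl, ctx.neg_mem, ctx.reflect_mem⟩
  | step _ hC _ ih => exact (ih.orthSub _).isComponent hC

theorem CascadeMem.isHighest {S : Finset V} {β : V} (h : ctx.CascadeMem S β) :
    ctx.IsHighest S β := by
  cases h with
  | top => exact ⟨ctx.pos_subset ctx.theta_mem, ctx.theta_mem, ctx.theta_highest⟩
  | step _ _ h => exact h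

/-- The descendant relation on cascade pairs, restricted to subsystems containing `γ`. -/
def StepThrough (ctx : RootSystemCtx V) (γ : V) (p q : Finset V × V) : Prop :=
  IsComponent (orthSub p.1 p.2) q.1 ∧ ctx.IsHighest q.1 q.2 ∧ γ ∈ q.1

theorem stepThrough_rightUnique (γ : V) : Relator.RightUnique (ctx.StepThrough γ) := by
  rintro p ⟨S, β⟩ ⟨S', β'⟩ ⟨hC, hh, hγ⟩ ⟨hC', hh', hγ'⟩
  obtain rfl : S = S' := (hC.eq_component hγ).trans (hC'.eq_component hγ').symm
  exact congrArg (Prod.mk S) (hh.unique hh')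

theorem CascadeMem.reflTransGen {S : Finset V} {β γ : V} (h : ctx.CascadeMem S β)
    (hγ : γ ∈ S) : Relation.ReflTransGen (ctx.StepThrough γ) (ctx.Δ, ctx.θ) (S, β) := by
  induction h with
  | top => exact .refl
  | step _ hC hh ih =>
    exact (ih (Finset.mem_of_mem_filter _ (hC.subset hγ))).tail ⟨hC, hh, hγ⟩

theorem eq_or_subset_orthSub_of_reflTransGen {γ : V} {p q : Finset V × V}
    (h : Relation.ReflTransGen (ctx.StepThrough γ) p q) :
    p = q ∨ q.1 ⊆ orthSub p.1 p.2 := by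
  induction h with
  | refl => exact Or.inl rfl
  | tail _ hs ih =>
    rcases ih with rfl | ih
    · exact Or.inr hs.1.subset
    · exact Or.inr ((hs.1.subset.trans (Finset.filter_subset _ _)).trans ih)

/-- Cascade pairs whose subsystems share a root are nested. -/
theorem CascadeMem.nested {S S' : Finset V} {β β' γ : V} (h : ctx.CascadeMem S β)
    (h' : ctx.CascadeMem S' β') (hγ : γ ∈ S) (hγ' : γ ∈ S') :
    (S = S' ∧ β = β') ∨ S' ⊆ orthSub S β ∨ S ⊆ orthSub S' β' := by
  rcases Relation.ReflTransGen.total_of_right_unique (stepThrough_rightUnique γ)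
    (h.reflTransGen hγ) (h'.reflTransGen hγ') with hr | hr
  · rcases eq_or_subset_orthSub_of_reflTransGen hr with e | hs
    · exact Or.inl (Prod.ext_iff.1 e)
    · exact Or.inr (Or.inl hs)
  · rcases eq_or_subset_orthSub_of_reflTransGen hr with e | hs
    · exact Or.inl (Prod.ext_iff.1 e.symm)
    · exact Or.inr (Or.inr hs)

theorem inner_eq_zero_of_mem_orthSub {S : Finset V} {β γ : V} (h : γ ∈ orthSub S β) :
    ⟪γ, β⟫ = 0 := (Finset.mem_filter.1 h).2

theorem CascadeMem.mem_or_orthogonal {S S' : Finset V} {β β' : V} (h : ctx.CascadeMem S β)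
    (h' : ctx.CascadeMem S' β') : β' ∈ S ∨ ∀ γ ∈ S, ⟪γ, β'⟫ = 0 := by
  induction h with
  | top => exact Or.inl (h'.isSubsystem.subset h'.isHighest.1)
  | @step S C β _ hS hC _ ih =>
    have hCS : C ⊆ S := hC.subset.trans (Finset.filter_subset _ _)
    rcases ih with hmem | horth
    · rcases hS.nested h' hmem h'.isHighest.1 with ⟨-, rfl⟩ | hs | hs
      · exact Or.inr fun γ hγ => inner_eq_zero_of_mem_orthSub (hC.subset hγ)
      · by_cases hβ' : β' ∈ C
        · exact Or.inl hβ'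
        · exact Or.inr fun γ hγ => hC.inner_eq_zero hγ (hs h'.isHighest.1) hβ'
      · exact Or.inr fun γ hγ => inner_eq_zero_of_mem_orthSub (hs (hCS hγ))
    · exact Or.inr fun γ hγ => horth γ (hCS hγ)

/-- Distinct elements of the cascade are orthogonal. -/
theorem CascadeMem.inner_eq_zero {S S' : Finset V} {β β' : V} (h : ctx.CascadeMem S β)
    (h' : ctx.CascadeMem S' β') (hne : β ≠ β') : ⟪β, β'⟫ = 0 := by
  rcases h.mem_or_orthogonal h' with hmem | horth
  · rcases h.nested h' hmem h'.isHighest.1 with ⟨-, e⟩ | hs | hs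
    · exact absurd e hne
    · rw [real_inner_comm]
      exact inner_eq_zero_of_mem_orthSub (hs h'.isHighest.1)
    · exact inner_eq_zero_of_mem_orthSub (hs h.isHighest.1)
  · exact horth β h.isHighest.1

theorem inner_cascElt_of_mem {K : Finset V} (hK : ctx.IsCascade K) {β : V} (hβ : β ∈ K) :
    ⟪β, cascElt K⟫ = 1 := by
  obtain ⟨S, hS⟩ := (hK β).1 hβ
  rw [cascElt, inner_sum, Finset.sum_eq_single_of_mem β hβ]
  · rw [inner_smul_right, inv_mul_cancel₀]
    exact inner_self_ne_zero.2 (ne_zero_of_mem (hS.isSubsystem.subset hS.isHighest.1))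
  · intro β' hβ' hne
    obtain ⟨S', hS'⟩ := (hK β').1 hβ'
    rw [inner_smul_right, hS.inner_eq_zero hS' hne.symm, mul_zero]

theorem CascadeMem.cartanPairing_eq_one {S : Finset V} {β γ : V} (h : ctx.CascadeMem S β)
    (hγ : γ ∈ ctx.heis S β) (hne : γ ≠ β) : cartanPairing γ β = 1 := by
  obtain ⟨hγS, -, hpos⟩ := Finset.mem_filter.1 hγ
  obtain ⟨hβS, hβpos, hmax⟩ := h.isHighest
  have hβ0 := ne_zero_of_mem (h.isSubsystem.subset hβS)
  have hrefl := h.isSubsystem.reflect_mem β hβS γ hγS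
  obtain ⟨k, hk⟩ := ctx.pairing_int β (h.isSubsystem.subset hβS) γ (h.isSubsystem.subset hγS)
  have hkpos : (0 : ℝ) < k := by
    rw [← hk, cartanPairing]
    exact div_pos (by linarith) (real_inner_self_pos.2 hβ0)
  have hkpos : 0 < k := by exact_mod_cast hkpos
  rw [hk] at hrefl ⊢
  by_contra hk1
  have hk2 : 2 ≤ k := by
    have : k ≠ 1 := fun e => hk1 (by rw [e, Int.cast_one])
    omega
  obtain ⟨n, rfl⟩ : ∃ n : ℕ, k = n + 2 := ⟨(k - 2).toNat, by omega⟩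
  have h1 := hmax _ (h.isSubsystem.neg_mem _ hrefl)
  have hγβ : γ - β ∈ AddSubmonoid.closure (ctx.base : Set V) := by
    have h2 := add_mem h1 (nsmul_mem (ctx.pos_coords β hβpos) n)
    convert h2 using 1
    rw [← Nat.cast_smul_eq_nsmul ℝ]
    push_cast
    module
  have h3 := hmax γ hγS
  refine hne (sub_eq_zero.1 (ctx.eq_zero_of_mem_closure_base hγβ ?_))
  rw [neg_sub]
  exact h3

/-- The Heisenberg subset without `β` is stable under `γ ↦ β - γ`. -/
theorem CascadeMem.sub_mem_heis {S : Finset V} {β γ : V} (h : ctx.CascadeMem S β)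
    (hγ : γ ∈ ctx.heis S β) (hne : γ ≠ β) : β - γ ∈ ctx.heis S β := by
  have hc := h.cartanPairing_eq_one hγ hne
  obtain ⟨hγS, -, hpos⟩ := Finset.mem_filter.1 hγ
  have hβS := h.isHighest.1
  have hmem : β - γ ∈ S := by
    have h1 := h.isSubsystem.neg_mem _ (h.isSubsystem.reflect_mem β hβS γ hγS)
    rwa [hc, one_smul, neg_sub] at h1
  refine Finset.mem_filter.2 ⟨hmem, mem_pos_of_mem_closure (h.isSubsystem.subset hmem)
    (h.isHighest.2.2 γ hγS), ?_⟩
  have hββ : 0 < ⟪β, β⟫ :=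
    real_inner_self_pos.2 (ne_zero_of_mem (h.isSubsystem.subset hβS))
  rw [cartanPairing, div_eq_one_iff_eq hββ.ne'] at hc
  rw [inner_sub_left]
  linarith

end RootSystemCtx

/-- The map `γ ↦ β_j - γ` (where `j` is the unique index with `γ ∈ H_{β_j}`) is a bijection
between `R_d = {γ ∈ Δ⁺ \\ K : γ(x_K) = d}` and `R_{1-d}`; in particular the multiset of
values of `x_K` on `Δ⁺ \\ K` is symmetric with respect to `1/2`. -/
theorem casc_value_symmetry {V : Type*} [NormedAddCommGroup V] [InnerProductSpace ℝ V]
    [FiniteDimensional ℝ V] (ctx : RootSystemCtx V)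
    (K : Finset V) (hK : ctx.IsCascade K)
    (Sub : V → Finset V) (hSub : ∀ β ∈ K, ctx.CascadeMem (Sub β) β)
    (idx : V → V)
    (hidx : ∀ γ ∈ ctx.Pos, idx γ ∈ K ∧ γ ∈ ctx.heis (Sub (idx γ)) (idx γ) ∧
      ∀ β ∈ K, γ ∈ ctx.heis (Sub β) β → β = idx γ) :
    ∀ d : ℝ,
      Set.BijOn (fun γ => idx γ - γ)
        {γ | γ ∈ ctx.Pos ∧ γ ∉ K ∧ ⟪γ, cascElt K⟫ = d}
        {γ | γ ∈ ctx.Pos ∧ γ ∉ K ∧ ⟪γ, cascElt K⟫ = 1 - d} ∧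
      (ctx.Pos.filter fun γ => γ ∉ K ∧ ⟪γ, cascElt K⟫ = d).card =
        (ctx.Pos.filter fun γ => γ ∉ K ∧ ⟪γ, cascElt K⟫ = 1 - d).card := by
  have hkey : ∀ γ ∈ ctx.Pos, γ ∉ K → idx γ - γ ∈ ctx.Pos ∧ idx γ - γ ∉ K ∧
      idx (idx γ - γ) = idx γ ∧ ⟪idx γ - γ, cascElt K⟫ = 1 - ⟪γ, cascElt K⟫ := by
    intro γ hγ hγK
    obtain ⟨hβK, hγH, -⟩ := hidx γ hγ
    have hsub := (hSub _ hβK).sub_mem_heis hγH fun e => hγK (e ▸ hβK)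
    have hpos : idx γ - γ ∈ ctx.Pos := (Finset.mem_filter.1 hsub).2.1
    have hidx' : idx γ = idx (idx γ - γ) := (hidx _ hpos).2.2 _ hβK hsub
    refine ⟨hpos, fun hK' => ?_, hidx'.symm, ?_⟩
    · have hS := hSub _ hK'
      have hδ := hS.isHighest
      have hself : idx γ - γ = idx (idx γ - γ) := (hidx _ hpos).2.2 _ hK' <|
        Finset.mem_filter.2 ⟨hδ.1, hpos, real_inner_self_pos.2
          (RootSystemCtx.ne_zero_of_mem (ctx.pos_subset hpos))⟩
      exact RootSystemCtx.ne_zero_of_mem (ctx.pos_subset hγ)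
        (sub_eq_self.1 (hself.trans hidx'.symm))
    · rw [inner_sub_left, RootSystemCtx.inner_cascElt_of_mem hK hβK]
  intro d
  have hmaps : ∀ c : ℝ, Set.MapsTo (fun γ => idx γ - γ)
      {γ | γ ∈ ctx.Pos ∧ γ ∉ K ∧ ⟪γ, cascElt K⟫ = c}
      {γ | γ ∈ ctx.Pos ∧ γ ∉ K ∧ ⟪γ, cascElt K⟫ = 1 - c} := by
    rintro c γ ⟨hγ, hγK, rfl⟩
    obtain ⟨h1, h2, -, h3⟩ := hkey γ hγ hγK
    exact ⟨h1, h2, h3⟩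
  have hinv : ∀ c : ℝ, Set.LeftInvOn (fun γ => idx γ - γ) (fun γ => idx γ - γ)
      {γ | γ ∈ ctx.Pos ∧ γ ∉ K ∧ ⟪γ, cascElt K⟫ = c} := by
    rintro c γ ⟨hγ, hγK, -⟩
    simp only [(hkey γ hγ hγK).2.2.1, sub_sub_cancel]
  have hbij : Set.BijOn (fun γ => idx γ - γ)
      {γ | γ ∈ ctx.Pos ∧ γ ∉ K ∧ ⟪γ, cascElt K⟫ = d}
      {γ | γ ∈ ctx.Pos ∧ γ ∉ K ∧ ⟪γ, cascElt K⟫ = 1 - d} :=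
    Set.InvOn.bijOn ⟨hinv d, hinv (1 - d)⟩ (hmaps d) (by simpa using hmaps (1 - d))
  refine ⟨hbij, Finset.card_nbij (fun γ => idx γ - γ) ?_ ?_ ?_⟩
  · simpa [Set.MapsTo] using hbij.mapsTo
  · simpa using hbij.injOn
  · simpa using hbij.surjOn
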